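/- arXiv:2406.13892 — 6 statements merged into one kernel-verified Lean document; each statement's English description precedes it below -/
import Mathlib

section
/- Let Σ be a finite alphabet, let M₁ be a DFA over Σ with state set Q₁, start state q₁, transition function δ₁ and accept-state set F₁, and suppose M₁ has a dead state d (i.e., d ∉ F₁ and δ₁(d, a) = d for every a ∈ Σ) such that δ₁(q, a) = d for every accept state q ∈ F₁ and every a ∈ Σ. Let M₂ be any DFA over Σ with state set Q₂. Then there exists a DFA M over Σ whose state type has cardinality |Q₁| − |F₁| + |Q₂| (obtained by merging the accept states of M₁ with the initial state of M₂) and whose accepted language equals the concatenation L(M₁) · L(M₂) = { u ++ v : u ∈ L(M₁), v ∈ L(M₂) }. -/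
open Classical in
/-- Embedding of the states of the first automaton in the merged state space. -/
noncomputable def mergeState {α σ₁ σ₂ : Type} (M₁ : DFA α σ₁) (M₂ : DFA α σ₂) (q : σ₁) :
    {q : σ₁ // q ∉ M₁.accept} ⊕ σ₂ :=
  if h : q ∈ M₁.accept then Sum.inr M₂.start else Sum.inl ⟨q, h⟩

/-- The merged automaton. -/
noncomputable def mergeDFA {α σ₁ σ₂ : Type} (M₁ : DFA α σ₁) (M₂ : DFA α σ₂) :
    DFA α ({q : σ₁ // q ∉ M₁.accept} ⊕ σ₂) where
  step s a := match s with
    | Sum.inl q => mergeState M₁ M₂ (M₁.step q.1 a)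
    | Sum.inr r => Sum.inr (M₂.step r a)
  start := mergeState M₁ M₂ M₁.start
  accept := {s | ∃ r, r ∈ M₂.accept ∧ Sum.inr r = s}

theorem mergeDFA_evalFrom_inr {α σ₁ σ₂ : Type} (M₁ : DFA α σ₁) (M₂ : DFA α σ₂) (x : List α)
    (r : σ₂) : (mergeDFA M₁ M₂).evalFrom (Sum.inr r) x = Sum.inr (M₂.evalFrom r x) := by
  induction x generalizing r with
  | nil => rfl
  | cons a x ih => exact ih _

theorem dead_evalFrom {α σ : Type} (M : DFA α σ) (d : σ) (hdead : ∀ a : α, M.step d a = d)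
    (x : List α) : M.evalFrom d x = d := by
  induction x with
  | nil => rfl
  | cons a x ih => rw [DFA.evalFrom_cons, hdead, ih]

theorem mergeDFA_spec {α σ₁ σ₂ : Type} (M₁ : DFA α σ₁) (M₂ : DFA α σ₂)
    (d : σ₁) (hd : d ∉ M₁.accept) (hdead : ∀ a : α, M₁.step d a = d)
    (hacc : ∀ q ∈ M₁.accept, ∀ a : α, M₁.step q a = d) (x : List α) (q : σ₁) :
    (mergeDFA M₁ M₂).evalFrom (mergeState M₁ M₂ q) x ∈ (mergeDFA M₁ M₂).accept ↔
      ∃ u v, u ++ v = x ∧ M₁.evalFrom q u ∈ M₁.accept ∧ M₂.evalFrom M₂.start v ∈ M₂.accept := by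
  induction x generalizing q with
  | nil =>
    by_cases h : q ∈ M₁.accept
    · simp [mergeState, h, mergeDFA]
    · simp [mergeState, h, mergeDFA]
  | cons a x ih =>
    by_cases h : q ∈ M₁.accept
    · have e : mergeState M₁ M₂ q = Sum.inr M₂.start := by simp [mergeState, h]
      rw [e, mergeDFA_evalFrom_inr]
      constructor
      · rintro ⟨r, hr, heq⟩
        cases heq
        exact ⟨[], a :: x, rfl, h, hr⟩
      · rintro ⟨u, v, huv, hu, hv⟩
        cases u with
        | nil =>
          simp only [List.nil_append] at huv
          subst huv
          exact ⟨_, hv, rfl⟩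
        | cons b u =>
          rw [DFA.evalFrom_cons, hacc q h, dead_evalFrom M₁ d hdead] at hu
          exact absurd hu hd
    · have e : mergeState M₁ M₂ q = Sum.inl ⟨q, h⟩ := by simp [mergeState, h]
      rw [e, DFA.evalFrom_cons]
      refine (ih (M₁.step q a)).trans ?_
      constructor
      · rintro ⟨u, v, rfl, hu, hv⟩
        exact ⟨a :: u, v, rfl, hu, hv⟩
      · rintro ⟨u, v, huv, hu, hv⟩
        cases u with
        | nil => exact absurd hu h
        | cons b u =>
          simp only [List.cons_append, List.cons.injEq] at huv
          obtain ⟨rfl, rfl⟩ := huv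
          exact ⟨u, v, rfl, hu, hv⟩

/-- **Concatenation of DFAs by merging accept states.**
If `M₁` has a dead state `d` such that every accept state transitions to `d` on every
symbol, then `M₁` can be concatenated with any DFA `M₂` by merging the accept states of
`M₁` with the initial state of `M₂`: there is a DFA with
`|Q₁| - |F₁| + |Q₂|` states recognizing the concatenation `L(M₁) · L(M₂)`. -/
theorem dfa_concat_of_dead_state {α σ₁ σ₂ : Type} [Fintype α] [Fintype σ₁] [Fintype σ₂]
    (M₁ : DFA α σ₁) (M₂ : DFA α σ₂)
    (d : σ₁) (hd : d ∉ M₁.accept) (hdead : ∀ a : α, M₁.step d a = d)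
    (hacc : ∀ q ∈ M₁.accept, ∀ a : α, M₁.step q a = d) :
    ∃ (Q : Type) (_ : Fintype Q) (M : DFA α Q),
      Fintype.card Q = Fintype.card σ₁ - M₁.accept.ncard + Fintype.card σ₂ ∧
      M.accepts = M₁.accepts * M₂.accepts := by
  classical
  refine ⟨{q : σ₁ // q ∉ M₁.accept} ⊕ σ₂, inferInstance, mergeDFA M₁ M₂, ?_, ?_⟩
  · rw [Fintype.card_sum, Fintype.card_subtype_compl (fun q => q ∈ M₁.accept),
      ← Nat.card_coe_set_eq, Nat.card_eq_fintype_card]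
  · ext x
    rw [Language.mem_mul]
    refine (mergeDFA_spec M₁ M₂ d hd hdead hacc x M₁.start).trans ?_
    constructor
    · rintro ⟨u, v, h, hu, hv⟩
      exact ⟨u, hu, v, hv, h⟩
    · rintro ⟨u, hu, v, hv, h⟩
      exact ⟨u, v, h, hu, hv⟩
end

section
/- Fix n ≥ 1, finite types Z and Σ, HMM parameters π, A, B, and a DFA M = (Q, Σ, δ, q₀, F). For 1 ≤ t ≤ n, z ∈ Z and s ∈ Q, define the acceptance quantity g_t(z, s) := Σ over all continuation token sequences x_{t+1}, …, x_n ∈ Σ such that running M from state s on x_{t+1}…x_n ends in a state of F, of Σ over all z_{t+1}, …, z_n ∈ Z of ∏_{u=t+1}^{n} A(z_{u−1}, z_u)·B(z_u, x_u) with z_t = z (with g_n(z, s) := 1 if s ∈ F and 0 otherwise). Then for every observed prefix x₁, …, x_t ∈ Σ and every z ∈ Z, the sum over all full sequences (x'₁:ₙ, z'₁:ₙ) with x'₁:ₜ = x₁:ₜ, z'_t = z, and M accepting x'₁:ₙ of p(x'₁:ₙ, z'₁:ₙ) equals α_t(z) · g_t(z, s_t), where α_t(z) := Σ over z₁, …,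 z_t with z_t = z of π(z₁)·B(z₁, x₁)·∏_{u=2}^{t} A(z_{u−1}, z_u)·B(z_u, x_u), and s_t is the state reached by M from q₀ on reading x₁…x_t. -/
open scoped NNReal

/-- The forward quantity `α_{t+1}(z)` of an HMM (`0`-based token indexing: `x 0` is `x₁`). -/
noncomputable def fwd {Z σ : Type} [Fintype Z] [DecidableEq Z]
    (π : Z → ℝ≥0) (A : Z → Z → ℝ≥0) (B : Z → σ → ℝ≥0) (x : ℕ → σ)
    (t : ℕ) (z : Z) : ℝ≥0 :=
  ∑ zs : Fin (t + 1) → Z,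
    if zs (Fin.last t) = z then
      π (zs 0) * B (zs 0) (x 0) *
        ∏ u : Fin t, A (zs u.castSucc) (zs u.succ) * B (zs u.succ) (x (u.val + 1))
    else 0

/-- The joint HMM weight `p(x₁:ₙ, z₁:ₙ) = π(z₁)·B(z₁,x₁)·∏_{u=2}^{n} A(z_{u-1},z_u)·B(z_u,x_u)`
of a full hidden sequence `zs` together with the observations `xs` (`0`-based indexing). -/
noncomputable def joint {Z σ : Type}
    (π : Z → ℝ≥0) (A : Z → Z → ℝ≥0) (B : Z → σ → ℝ≥0)
    (n : ℕ) (xs : Fin n → σ) (zs : Fin n → Z) : ℝ≥0 :=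
  ∏ u : Fin n,
    (if _ : u.val = 0 then π (zs u)
      else A (zs ⟨u.val - 1, lt_of_le_of_lt (Nat.sub_le _ _) u.isLt⟩) (zs u))
      * B (zs u) (xs u)

/-- The acceptance quantity `g_t(z, s)` of an HMM with respect to a DFA `M` and horizon `n`
(`1`-based `t`): the sum, over all continuation token sequences `x_{t+1}, …, x_n` such that
running `M` from the state `s` on `x_{t+1} … x_n` ends in an accept state, of the sum over
all hidden continuations `z_{t+1}, …, z_n` of `∏_{u=t+1}^{n} A(z_{u-1}, z_u)·B(z_u, x_u)`
where `z_t = z`.  In particular `accQ A B M n n z s` is `1` if `s ∈ M.accept` and `0`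
otherwise. -/
noncomputable def accQ {Z σ Q : Type} [Fintype Z] [Fintype σ]
    (A : Z → Z → ℝ≥0) (B : Z → σ → ℝ≥0) (M : DFA σ Q) [DecidablePred (· ∈ M.accept)]
    (n t : ℕ) (z : Z) (s : Q) : ℝ≥0 :=
  ∑ xs : Fin (n - t) → σ, ∑ zs : Fin (n - t) → Z,
    if M.evalFrom s (List.ofFn xs) ∈ M.accept then
      ∏ u : Fin (n - t),
        A (if _ : u.val = 0 then z
            else zs ⟨u.val - 1, lt_of_le_of_lt (Nat.sub_le _ _) u.isLt⟩) (zs u)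
          * B (zs u) (xs u)
    else 0

theorem accQ_of_eq {Z σ Q : Type} [Fintype Z] [Fintype σ]
    (A : Z → Z → ℝ≥0) (B : Z → σ → ℝ≥0) (M : DFA σ Q) [DecidablePred (· ∈ M.accept)]
    (n t m : ℕ) (h : n - t = m) (z : Z) (s : Q) :
    accQ A B M n t z s = ∑ xs : Fin m → σ, ∑ zs : Fin m → Z,
      if M.evalFrom s (List.ofFn xs) ∈ M.accept then
        ∏ u : Fin m,
          A (if _ : u.val = 0 then z
              else zs ⟨u.val - 1, lt_of_le_of_lt (Nat.sub_le _ _) u.isLt⟩) (zs u)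
            * B (zs u) (xs u)
      else 0 := by
  subst h; rfl

theorem joint_append {Z σ : Type}
    (π : Z → ℝ≥0) (A : Z → Z → ℝ≥0) (B : Z → σ → ℝ≥0) (k m : ℕ)
    (xa : Fin (k + 1) → σ) (xb : Fin m → σ) (za : Fin (k + 1) → Z) (zb : Fin m → Z) :
    joint π A B (k + 1 + m) (Fin.append xa xb) (Fin.append za zb) =
      (π (za 0) * B (za 0) (xa 0) *
        ∏ u : Fin k, A (za u.castSucc) (za u.succ) * B (za u.succ) (xa u.succ)) *
      ∏ u : Fin m,
        A (if _ : u.val = 0 then za (Fin.last k)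
            else zb ⟨u.val - 1, lt_of_le_of_lt (Nat.sub_le _ _) u.isLt⟩) (zb u)
          * B (zb u) (xb u) := by
  unfold joint
  rw [Fin.prod_univ_add, Fin.prod_univ_succ]
  congr 1
  · congr 1
    · refine Finset.prod_congr rfl fun u _ => ?_
      rw [dif_neg (by simp)]
      have e : (⟨(Fin.castAdd m u.succ).val - 1,
          lt_of_le_of_lt (Nat.sub_le _ _) (Fin.castAdd m u.succ).isLt⟩ : Fin (k + 1 + m)) =
          Fin.castAdd m u.castSucc := by
        ext; simp
      rw [e]
      simp only [Fin.append_left]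
  · refine Finset.prod_congr rfl fun u _ => ?_
    rw [dif_neg (by simp)]
    simp only [Fin.append_right]
    congr 2
    by_cases h : u.val = 0
    · rw [dif_pos h]
      have e : (⟨(Fin.natAdd (k + 1) u).val - 1,
          lt_of_le_of_lt (Nat.sub_le _ _) (Fin.natAdd (k + 1) u).isLt⟩ : Fin (k + 1 + m)) =
          Fin.castAdd m (Fin.last k) := by
        ext; simp [h]
      rw [e, Fin.append_left]
    · rw [dif_neg h]
      have e : (⟨(Fin.natAdd (k + 1) u).val - 1,
          lt_of_le_of_lt (Nat.sub_le _ _) (Fin.natAdd (k + 1) u).isLt⟩ : Fin (k + 1 + m)) =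
          Fin.natAdd (k + 1) ⟨u.val - 1, lt_of_le_of_lt (Nat.sub_le _ _) u.isLt⟩ := by
        ext; simp; omega
      rw [e, Fin.append_right]

theorem sum_append {α : Type} [Fintype α] (k m : ℕ) (f : (Fin (k + m) → α) → ℝ≥0) :
    ∑ y, f y = ∑ a : Fin k → α, ∑ b : Fin m → α, f (Fin.append a b) := by
  rw [← (Fin.appendEquiv k m).sum_comp f, Fintype.sum_prod_type]
  rfl

/-- **Forward decomposition of the acceptance-constrained marginal.**
For `1 ≤ t ≤ n`, an observed prefix `x₁, …, x_t` (written `0`-based as `x 0, …, x (t-1)`)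
and `z ∈ Z`: the sum over all full sequences `(x'₁:ₙ, z'₁:ₙ)` with `x'₁:ₜ = x₁:ₜ`,
`z'_t = z`, and `M` accepting `x'₁:ₙ`, of `p(x'₁:ₙ, z'₁:ₙ)`, equals `α_t(z) · g_t(z, s_t)`,
where `s_t` is the state reached by `M` from its start state on reading `x₁ … x_t`. -/
theorem hmm_dfa_forward_acceptance {Z σ Q : Type}
    [Fintype Z] [DecidableEq Z] [Fintype σ] [DecidableEq σ]
    (n : ℕ) (hn : 1 ≤ n)
    (π : Z → ℝ≥0) (A : Z → Z → ℝ≥0) (B : Z → σ → ℝ≥0)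
    (M : DFA σ Q) [DecidablePred (· ∈ M.accept)]
    (x : ℕ → σ) (t : ℕ) (ht1 : 1 ≤ t) (ht2 : t ≤ n) (z : Z) :
    (∑ xs' : Fin n → σ, ∑ zs' : Fin n → Z,
        if (∀ i : Fin n, i.val < t → xs' i = x i.val) ∧ zs' ⟨t - 1, by omega⟩ = z ∧
            M.eval (List.ofFn xs') ∈ M.accept then
          joint π A B n xs' zs'
        else 0)
      = fwd π A B x (t - 1) z *
          accQ A B M n t z (M.eval (List.ofFn fun i : Fin t => x i.val)) := by
  classical
  obtain ⟨k, rfl⟩ : ∃ k, t = k + 1 := ⟨t - 1, by omega⟩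
  obtain ⟨m, rfl⟩ := Nat.exists_eq_add_of_le ht2
  rw [accQ_of_eq A B M (k + 1 + m) (k + 1) m (by omega), sum_append]
  have hx : ∀ (xa : Fin (k + 1) → σ) (xb : Fin m → σ),
      (∀ i : Fin (k + 1 + m), i.val < k + 1 → Fin.append xa xb i = x i.val) ↔
        xa = fun i => x i.val := by
    intro xa xb
    constructor
    · intro h
      ext i
      have := h (Fin.castAdd m i) i.isLt
      simpa using this
    · rintro rfl i hi
      have e : i = Fin.castAdd m ⟨i.val, hi⟩ := rfl
      rw [e, Fin.append_left]
      rfl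
  have hz : (⟨k + 1 - 1, by omega⟩ : Fin (k + 1 + m)) = Fin.castAdd m (Fin.last k) := by
    ext; simp
  rw [Finset.sum_eq_single (fun i : Fin (k + 1) => x i.val)]
  · simp only [hz, hx, true_and]
    rw [Finset.mul_sum]
    refine Finset.sum_congr rfl fun xb _ => ?_
    rw [sum_append]
    unfold fwd
    rw [Finset.sum_mul_sum]
    refine Finset.sum_congr rfl fun za _ => Finset.sum_congr rfl fun zb _ => ?_
    rw [joint_append, Fin.append_left, List.ofFn_fin_append]
    have he : M.eval ((List.ofFn fun i : Fin (k + 1) => x i.val) ++ List.ofFn xb) =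
        M.evalFrom (M.eval (List.ofFn fun i : Fin (k + 1) => x i.val)) (List.ofFn xb) :=
      DFA.evalFrom_of_append M _ _ _
    simp only [he]
    by_cases h1 : za (Fin.last k) = z
    · by_cases h2 : M.evalFrom (M.eval (List.ofFn fun i : Fin (k + 1) => x i.val))
          (List.ofFn xb) ∈ M.accept
      · rw [if_pos ⟨h1, h2⟩, if_pos h2]
        subst h1
        erw [if_pos rfl]
        rfl
      · rw [if_neg (fun h => h2 h.2), if_neg h2, mul_zero]
    · rw [if_neg (fun h => h1 h.1)]
      erw [if_neg h1]
      rw [zero_mul]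
  · intro xa _ hne
    refine Finset.sum_eq_zero fun xb _ => Finset.sum_eq_zero fun zs _ => ?_
    rw [if_neg]
    rintro ⟨h, -⟩
    exact hne ((hx xa xb).1 h)
  · intro h
    exact absurd (Finset.mem_univ _) h
end

section
/- Let Σ be a finite alphabet and let w be a nonempty word over Σ of length ℓ. Then there exists a DFA over Σ whose state type has exactly ℓ + 1 states (the Knuth–Morris–Pratt automaton of w) and whose accepted language is exactly the set of strings s over Σ that contain w as a contiguous substring (infix). -/
open Classical in
/-- Length of the longest prefix of `w` that is a suffix of `s`. -/
noncomputable def kmpBorder {σ : Type} (w s : List σ) : ℕ :=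
  Nat.findGreatest (fun k => w.take k <:+ s) w.length

theorem kmpBorder_le {σ : Type} (w s : List σ) : kmpBorder w s ≤ w.length := by
  classical exact Nat.findGreatest_le _

theorem kmpBorder_suffix {σ : Type} (w s : List σ) : w.take (kmpBorder w s) <:+ s := by
  classical
  unfold kmpBorder
  exact Nat.findGreatest_spec (P := fun k => w.take k <:+ s) (Nat.zero_le w.length) (by simp)

theorem le_kmpBorder {σ : Type} (w s : List σ) {k : ℕ} (hk : k ≤ w.length)
    (h : w.take k <:+ s) : k ≤ kmpBorder w s := by
  classical
  unfold kmpBorder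
  exact Nat.le_findGreatest (P := fun k => w.take k <:+ s) hk h

theorem kmpBorder_eq_length {σ : Type} (w s : List σ) :
    kmpBorder w s = w.length ↔ w <:+ s := by
  constructor
  · intro h
    have := kmpBorder_suffix w s
    rwa [h, List.take_length] at this
  · intro h
    exact le_antisymm (kmpBorder_le w s) (le_kmpBorder w s le_rfl (by rwa [List.take_length]))

theorem kmpBorder_step {σ : Type} (w s : List σ) (a : σ) :
    kmpBorder w (w.take (kmpBorder w s) ++ [a]) = kmpBorder w (s ++ [a]) := by
  have hsuf := kmpBorder_suffix w s
  apply le_antisymm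
  · refine le_kmpBorder _ _ (kmpBorder_le _ _) ((kmpBorder_suffix _ _).trans ?_)
    obtain ⟨t, ht⟩ := hsuf
    exact ⟨t, by rw [← List.append_assoc, ht]⟩
  · refine le_kmpBorder _ _ (kmpBorder_le _ _) ?_
    have h := kmpBorder_suffix w (s ++ [a])
    have hl := kmpBorder_le w (s ++ [a])
    generalize kmpBorder w (s ++ [a]) = k at h hl
    cases k with
    | zero => simp
    | succ j =>
      have hj : j < w.length := hl
      rw [← List.take_concat_get' w j hj] at h ⊢
      obtain ⟨t, ht⟩ := h
      rw [← List.append_assoc] at ht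
      obtain ⟨h1, h2⟩ := List.append_inj' ht rfl
      have hjs : w.take j <:+ s := ⟨t, h1⟩
      have hle := le_kmpBorder w s hj.le hjs
      have hb := kmpBorder_le w s
      obtain ⟨u, hu⟩ := List.suffix_of_suffix_length_le hjs hsuf (by simp; omega)
      exact ⟨u, by rw [← List.append_assoc, hu, h2]⟩

open Classical in
/-- The KMP automaton of `w`. -/
noncomputable def kmpDFA {σ : Type} (w : List σ) : DFA σ (Fin (w.length + 1)) where
  step q a := if q.1 = w.length then q
    else ⟨kmpBorder w (w.take q.1 ++ [a]), Nat.lt_succ_of_le (kmpBorder_le _ _)⟩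
  start := 0
  accept := {q | q.1 = w.length}

theorem kmpDFA_eval {σ : Type} (w : List σ) (hw : w ≠ []) (s : List σ) :
    (w <:+: s → ((kmpDFA w).eval s).1 = w.length) ∧
    (¬ w <:+: s → ((kmpDFA w).eval s).1 = kmpBorder w s) := by
  induction s using List.reverseRecOn with
  | nil =>
    refine ⟨fun h => absurd (List.infix_nil.1 h) hw, fun _ => ?_⟩
    have h := (kmpBorder_suffix w []).length_le
    have h2 := kmpBorder_le w []
    simp only [List.length_take, List.length_nil] at h
    have : kmpBorder w [] = 0 := by omega
    rw [this]; rfl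
  | append_singleton s a ih =>
    rw [DFA.eval_append_singleton]
    by_cases hs : w <:+: s
    · have h1 : ((kmpDFA w).step ((kmpDFA w).eval s) a) = (kmpDFA w).eval s :=
        if_pos (ih.1 hs)
      rw [h1]
      exact ⟨fun _ => ih.1 hs,
        fun h => absurd (hs.trans (List.prefix_append s [a]).isInfix) h⟩
    · have he := ih.2 hs
      have hne : ((kmpDFA w).eval s).1 ≠ w.length := by
        rw [he]
        exact fun h => hs ((kmpBorder_eq_length w s).1 h).isInfix
      have h1 : ((kmpDFA w).step ((kmpDFA w).eval s) a).1 = kmpBorder w (s ++ [a]) := by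
        rw [← kmpBorder_step, ← he]
        simp only [kmpDFA] at hne ⊢
        rw [if_neg hne]
      rw [h1]
      refine ⟨fun h => ?_, fun _ => rfl⟩
      rw [kmpBorder_eq_length]
      exact (List.infix_concat_iff.1 h).resolve_right hs

/-- **KMP automaton.** For any nonempty word `w` over a finite alphabet `σ`, there is a
DFA with exactly `w.length + 1` states whose accepted language is exactly the set of
strings containing `w` as a contiguous substring (infix). -/
theorem kmp_dfa_infix {σ : Type} [Fintype σ] (w : List σ) (hw : w ≠ []) :
    ∃ (Q : Type) (_ : Fintype Q) (M : DFA σ Q),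
      Fintype.card Q = w.length + 1 ∧
      M.accepts = {s : List σ | w <:+: s} := by
  refine ⟨Fin (w.length + 1), inferInstance, kmpDFA w, Fintype.card_fin _, ?_⟩
  ext s
  rw [DFA.mem_accepts]
  change ((kmpDFA w).eval s).1 = w.length ↔ w <:+: s
  refine ⟨fun h => ?_, (kmpDFA_eval w hw s).1⟩
  by_contra hs
  rw [(kmpDFA_eval w hw s).2 hs, kmpBorder_eq_length] at h
  exact hs h.isInfix
end

section
/- Let Σ be a finite alphabet and let w be a nonempty word over Σ of length ℓ. Then there exists a DFA over Σ whose state type has exactly ℓ + 1 states and whose accepted language is exactly the set of strings s over Σ that end with w, i.e., such that w is a suffix of s. -/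
open Classical in
/-- Length of the longest prefix of `w` that is a suffix of `s`. -/
noncomputable def kmpL {σ : Type} (w s : List σ) : ℕ :=
  Nat.findGreatest (fun k => w.take k <:+ s) w.length

theorem kmpL_le {σ : Type} (w s : List σ) : kmpL w s ≤ w.length := by
  classical
  exact Nat.findGreatest_le _

theorem kmpL_suffix {σ : Type} (w s : List σ) : w.take (kmpL w s) <:+ s := by
  classical
  unfold kmpL
  exact Nat.findGreatest_spec (P := fun k => w.take k <:+ s) (m := 0) (Nat.zero_le _) (by simp)

theorem le_kmpL {σ : Type} (w s : List σ) (k : ℕ) (hk : k ≤ w.length) (h : w.take k <:+ s) :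
    k ≤ kmpL w s := by
  classical
  unfold kmpL
  exact Nat.le_findGreatest hk h

theorem kmpL_step {σ : Type} (w s : List σ) (a : σ) :
    kmpL w (w.take (kmpL w s) ++ [a]) = kmpL w (s ++ [a]) := by
  apply le_antisymm
  · apply le_kmpL _ _ _ (kmpL_le _ _)
    refine (kmpL_suffix w _).trans ?_
    obtain ⟨t, ht⟩ := kmpL_suffix w s
    exact ⟨t, by rw [← List.append_assoc, ht]⟩
  · apply le_kmpL _ _ _ (kmpL_le _ _)
    have h := kmpL_suffix w (s ++ [a])
    have hl := kmpL_le w (s ++ [a])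
    generalize kmpL w (s ++ [a]) = j at h hl
    cases j with
    | zero => simp
    | succ i =>
      have hi : i < w.length := hl
      rw [List.take_succ_eq_append_getElem hi] at h ⊢
      obtain ⟨t, ht⟩ := h
      rw [← List.append_assoc] at ht
      obtain ⟨h1, h2⟩ := List.append_inj' ht rfl
      have h3 : w.take i <:+ s := ⟨t, h1⟩
      have h4 := le_kmpL w s i hi.le h3
      have h5 : w.take i <:+ w.take (kmpL w s) :=
        List.suffix_of_suffix_length_le h3 (kmpL_suffix w s)
          (by simp only [List.length_take]; omega)
      obtain ⟨u, hu⟩ := h5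
      exact ⟨u, by rw [← List.append_assoc, hu, h2]⟩

/-- For any nonempty word `w` over a finite alphabet `σ`, there is a DFA with exactly
`w.length + 1` states whose accepted language is exactly the set of strings ending with
`w`, i.e., having `w` as a suffix. -/
theorem kmp_dfa_suffix {σ : Type} [Fintype σ] (w : List σ) (hw : w ≠ []) :
    ∃ (Q : Type) (_ : Fintype Q) (M : DFA σ Q),
      Fintype.card Q = w.length + 1 ∧
      M.accepts = {s : List σ | w <:+ s} := by
  let f : List σ → Fin (w.length + 1) := fun s => ⟨kmpL w s, Nat.lt_succ_of_le (kmpL_le w s)⟩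
  let M : DFA σ (Fin (w.length + 1)) :=
    { step := fun q a => f (w.take q.1 ++ [a])
      start := f []
      accept := {q | q.1 = w.length} }
  refine ⟨Fin (w.length + 1), inferInstance, M, by simp, ?_⟩
  have key : ∀ s, M.eval s = f s := by
    intro s
    induction s using List.reverseRecOn with
    | nil => rfl
    | append_singleton s a ih =>
      rw [DFA.eval_append_singleton, ih]
      exact Fin.ext (kmpL_step w s a)
  ext s
  rw [DFA.mem_accepts, key]
  change kmpL w s = w.length ↔ w <:+ s
  constructor
  · intro h
    have := kmpL_suffix w s
    rwa [h, List.take_length] at this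
  · intro h
    exact le_antisymm (kmpL_le w s) (le_kmpL w s _ le_rfl (by rwa [List.take_length]))
end

section
/- Let Σ be a finite alphabet and let K be a finite nonempty set of nonempty words over Σ. Then there exists a DFA over Σ whose state type has at most 1 + Σ_{w ∈ K} |w| states (the Aho–Corasick automaton of K) and whose accepted language is exactly the set of strings s over Σ that contain at least one word of K as a contiguous substring (infix). -/
open Classical in
/-- Longest suffix of a word lying in `P`. -/
noncomputable def acLsp {σ : Type} (P : Finset (List σ)) : List σ → List σ
  | [] => []
  | a :: l => if a :: l ∈ P then a :: l else acLsp P l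

lemma acLsp_suffix {σ : Type} (P : Finset (List σ)) (l : List σ) : acLsp P l <:+ l := by
  induction l with
  | nil => simp [acLsp]
  | cons a l ih =>
    unfold acLsp
    split_ifs
    · exact List.suffix_refl _
    · exact ih.trans (List.suffix_cons a l)

lemma acLsp_mem {σ : Type} (P : Finset (List σ)) (h0 : [] ∈ P) (l : List σ) :
    acLsp P l ∈ P := by
  induction l with
  | nil => simpa [acLsp] using h0
  | cons a l ih =>
    unfold acLsp
    split_ifs with h
    · exact h
    · exact ih

lemma acLsp_max {σ : Type} (P : Finset (List σ)) (p : List σ) (hp : p ∈ P) (l : List σ)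
    (h : p <:+ l) : p <:+ acLsp P l := by
  induction l with
  | nil => simpa [acLsp] using h
  | cons a l ih =>
    unfold acLsp
    split_ifs with h'
    · exact h
    · rcases List.suffix_cons_iff.1 h with rfl | h2
      · exact absurd hp h'
      · exact ih h2

lemma acLsp_step {σ : Type} (P : Finset (List σ)) (h0 : [] ∈ P)
    (hc : ∀ p q, p <+: q → q ∈ P → p ∈ P) (s : List σ) (a : σ) :
    acLsp P (acLsp P s ++ [a]) = acLsp P (s ++ [a]) := by
  have anti : ∀ {x y : List σ}, x <:+ y → y <:+ x → x = y := fun h1 h2 =>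
    h1.eq_of_length (le_antisymm h1.length_le h2.length_le)
  apply anti
  · apply acLsp_max _ _ (acLsp_mem P h0 _)
    refine (acLsp_suffix P _).trans ?_
    obtain ⟨t, ht⟩ := acLsp_suffix P s
    exact ⟨t, by rw [← List.append_assoc, ht]⟩
  · apply acLsp_max _ _ (acLsp_mem P h0 _)
    have hm := acLsp_mem P h0 (s ++ [a])
    have hs := acLsp_suffix P (s ++ [a])
    generalize acLsp P (s ++ [a]) = p at hm hs
    rcases List.eq_nil_or_concat p with rfl | ⟨p', b, rfl⟩
    · exact List.nil_suffix
    · simp only [List.concat_eq_append] at *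
      obtain ⟨t, ht⟩ := hs
      rw [← List.append_assoc] at ht
      obtain ⟨h1, h2⟩ := List.append_inj' ht rfl
      obtain ⟨u, hu⟩ := acLsp_max P p' (hc _ _ (List.prefix_append _ _) hm) s ⟨t, h1⟩
      exact ⟨u, by rw [← List.append_assoc, hu, h2]⟩

lemma infix_concat_cases {σ : Type} {w s : List σ} {a : σ} (h : w <:+: s ++ [a]) :
    w <:+: s ∨ w <:+ s ++ [a] := by
  obtain ⟨u, v, h⟩ := h
  rcases List.eq_nil_or_concat v with rfl | ⟨v', b, rfl⟩
  · right
    exact ⟨u, by simpa using h⟩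
  · left
    rw [List.concat_eq_append, ← List.append_assoc] at h
    exact ⟨u, v', (List.append_inj' h rfl).1⟩

/-- **Aho–Corasick automaton.** For any finite nonempty set `K` of nonempty words over a
finite alphabet `σ`, there is a DFA with at most `1 + ∑_{w ∈ K} |w|` states whose accepted
language is exactly the set of strings containing at least one word of `K` as a contiguous
substring (infix). -/
theorem aho_corasick_dfa {σ : Type} [Fintype σ]
    (K : Finset (List σ)) (hK : K.Nonempty) (hK' : ∀ w ∈ K, w ≠ []) :
    ∃ (Q : Type) (_ : Fintype Q) (M : DFA σ Q),
      Fintype.card Q ≤ 1 + ∑ w ∈ K, w.length ∧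
      M.accepts = {s : List σ | ∃ w ∈ K, w <:+: s} := by
  classical
  let P : Finset (List σ) := insert []
    (K.biUnion fun w => (Finset.range w.length).image (fun i => w.take (i + 1)))
  have hcard : P.card ≤ 1 + ∑ w ∈ K, w.length := by
    refine (Finset.card_insert_le _ _).trans ?_
    rw [add_comm]
    refine Nat.add_le_add_left (Finset.card_biUnion_le.trans (Finset.sum_le_sum ?_)) 1
    intro w _
    exact Finset.card_image_le.trans (by simp)
  have hP : ∀ p, p ∈ P ↔ ∃ w ∈ K, p <+: w := by
    intro p
    simp only [P, Finset.mem_insert, Finset.mem_biUnion, Finset.mem_image, Finset.mem_range]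
    constructor
    · rintro (rfl | ⟨w, hw, i, hi, rfl⟩)
      · obtain ⟨w, hw⟩ := hK
        exact ⟨w, hw, List.nil_prefix⟩
      · exact ⟨w, hw, List.take_prefix _ _⟩
    · rintro ⟨w, hw, h⟩
      by_cases hp : p = []
      · exact Or.inl hp
      · right
        have := List.length_pos_iff.2 hp
        have h2 := h.length_le
        refine ⟨w, hw, p.length - 1, by omega, ?_⟩
        rw [Nat.sub_add_cancel this]
        exact (List.prefix_iff_eq_take.1 h).symm
  have h0 : [] ∈ P := Finset.mem_insert_self _ _
  have hc : ∀ p q, p <+: q → q ∈ P → p ∈ P := by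
    intro p q h hq
    obtain ⟨w, hw, h'⟩ := (hP q).1 hq
    exact (hP p).2 ⟨w, hw, h.trans h'⟩
  clear_value P
  let Hit : List σ → Prop := fun s => ∃ w ∈ K, w <:+: s
  let M : DFA σ {x // x ∈ P} :=
    { step := fun q a => if Hit q.1 then q else ⟨acLsp P (q.1 ++ [a]), acLsp_mem P h0 _⟩
      start := ⟨[], h0⟩
      accept := {q | Hit q.1} }
  have inv : ∀ s, (Hit s ∧ Hit (M.eval s).1) ∨ (¬ Hit s ∧ (M.eval s).1 = acLsp P s) := by
    intro s
    induction s using List.reverseRecOn with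
    | nil =>
      right
      refine ⟨?_, by simp [M, acLsp]⟩
      rintro ⟨w, hw, h⟩
      exact hK' w hw (List.infix_nil.1 h)
    | append_singleton s a ih =>
      rw [DFA.eval_append_singleton]
      rcases ih with ⟨h1, h2⟩ | ⟨h1, h2⟩
      · left
        constructor
        · obtain ⟨w, hw, h⟩ := h1
          exact ⟨w, hw, h.trans (List.prefix_append _ _).isInfix⟩
        · have : M.step (M.eval s) a = M.eval s := if_pos h2
          rw [this]
          exact h2
      · have hn : ¬ Hit (M.eval s).1 := by
          rw [h2]
          rintro ⟨w, hw, h⟩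
          exact h1 ⟨w, hw, h.trans (acLsp_suffix P s).isInfix⟩
        have e : M.step (M.eval s) a = ⟨acLsp P ((M.eval s).1 ++ [a]), acLsp_mem P h0 _⟩ :=
          if_neg hn
        have e2 : (M.step (M.eval s) a).1 = acLsp P (s ++ [a]) := by
          rw [e]
          simp only [h2]
          exact acLsp_step P h0 hc s a
        by_cases hh : Hit (s ++ [a])
        · left
          refine ⟨hh, ?_⟩
          rw [e2]
          obtain ⟨w, hw, h⟩ := hh
          rcases infix_concat_cases h with h | h
          · exact absurd ⟨w, hw, h⟩ h1
          · exact ⟨w, hw,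
              (acLsp_max P w ((hP w).2 ⟨w, hw, List.prefix_refl _⟩) _ h).isInfix⟩
        · exact Or.inr ⟨hh, e2⟩
  refine ⟨{x // x ∈ P}, inferInstance, M, by simpa using hcard, ?_⟩
  ext s
  rw [DFA.mem_accepts]
  change Hit (M.eval s).1 ↔ Hit s
  rcases inv s with ⟨h1, h2⟩ | ⟨h1, h2⟩
  · exact ⟨fun _ => h1, fun _ => h2⟩
  · refine ⟨?_, fun h => absurd h h1⟩
    rw [h2]
    rintro ⟨w, hw, h⟩
    exact ⟨w, hw, h.trans (acLsp_suffix P s).isInfix⟩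
end

section
/- Let Σ be a finite alphabet and let w₁, …, w_k be nonempty words over Σ. Then there exists a DFA over Σ whose state type has at most 1 + Σ_{i=1}^{k} |w_i| states and whose accepted language is exactly the set of strings s over Σ that contain w₁, …, w_k as contiguous substrings occurring in the given order without overlap, i.e., s ∈ Σ* w₁ Σ* w₂ Σ* ⋯ Σ* w_k Σ*: there exist strings u₀, u₁, …, u_k with s = u₀ ++ w₁ ++ u₁ ++ w₂ ++ ⋯ ++ w_k ++ u_k. -/
/-- The target language `Σ* w₁ Σ* ⋯ w_k Σ*`. -/
def OKLang {σ : Type} (k : ℕ) (ws : Fin k → List σ) : Set (List σ) :=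
  {s : List σ | ∃ u : Fin (k + 1) → List σ,
        s = (List.ofFn fun i : Fin k => u i.castSucc ++ ws i).flatten ++ u (Fin.last k)}

theorem okLang_zero {σ : Type} (ws : Fin 0 → List σ) (s : List σ) : s ∈ OKLang 0 ws :=
  ⟨fun _ => s, by simp⟩

theorem okLang_succ {σ : Type} (k : ℕ) (ws : Fin (k + 1) → List σ) (s : List σ) :
    s ∈ OKLang (k + 1) ws ↔
      ∃ u t, s = u ++ (ws 0 ++ t) ∧ t ∈ OKLang k (fun i => ws i.succ) := by
  constructor
  · rintro ⟨u, hu⟩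
    refine ⟨u 0, _, ?_, fun i => u i.succ, rfl⟩
    rw [hu, List.ofFn_succ]
    simp [List.append_assoc]
  · rintro ⟨v, t, rfl, u, rfl⟩
    refine ⟨Fin.cons v u, ?_⟩
    rw [List.ofFn_succ, ← Fin.succ_last]
    simp [List.append_assoc, ← Fin.succ_castSucc]

theorem okLang_append {σ : Type} (k : ℕ) (ws : Fin k → List σ) (v s : List σ)
    (hs : s ∈ OKLang k ws) : v ++ s ∈ OKLang k ws := by
  cases k with
  | zero => exact okLang_zero _ _
  | succ k =>
    rw [okLang_succ] at hs ⊢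
    obtain ⟨u, t, rfl, ht⟩ := hs
    exact ⟨v ++ u, t, by simp, ht⟩

/-- `Σ* w L`. -/
def OKPre {σ : Type} (w : List σ) (L : Set (List σ)) : Set (List σ) :=
  {s | ∃ u t, s = u ++ (w ++ t) ∧ t ∈ L}

theorem okPre_next {σ : Type} (w : List σ) (hw : w ≠ []) (L : Set (List σ)) :
    ∀ p : List σ, p.length ≤ w.length → p ≠ w →
      ∃ j : Fin w.length, ∀ s, w.take j ++ s ∈ OKPre w L ↔ p ++ s ∈ OKPre w L := by
  intro p
  induction p with
  | nil =>
    intro _ _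
    exact ⟨⟨0, List.length_pos_iff.mpr hw⟩, by simp⟩
  | cons b p ih =>
    intro hl hne
    by_cases hp : (b :: p) <+: w
    · have hlt : (b :: p).length < w.length := by
        rcases lt_or_eq_of_le hl with h | h
        · exact h
        · exact absurd (hp.eq_of_length h) hne
      refine ⟨⟨_, hlt⟩, fun s => ?_⟩
      rw [← List.prefix_iff_eq_take.mp hp]
    · have hl' : p.length < w.length := by simpa using hl
      obtain ⟨j, hj⟩ := ih hl'.le (fun h => by simp [h] at hl')
      refine ⟨j, fun s => (hj s).trans ⟨?_, ?_⟩⟩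
      · rintro ⟨u, t, h, ht⟩
        exact ⟨b :: u, t, by simp [h], ht⟩
      · rintro ⟨u, t, h, ht⟩
        cases u with
        | nil =>
          refine absurd ?_ hp
          refine List.prefix_of_prefix_length_le (l₃ := b :: p ++ s) ⟨s, rfl⟩ ⟨t, ?_⟩ hl
          simpa using h.symm
        | cons c u =>
          simp only [List.cons_append, List.cons.injEq] at h
          exact ⟨u, t, h.2, ht⟩

open Classical in
/-- The KMP automaton of `w` followed by `M`. -/
noncomputable def okDFA {σ Q : Type} (w : List σ) (hw : w ≠ []) (M : DFA σ Q) :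
    DFA σ (Fin w.length ⊕ Q) where
  start := Sum.inl ⟨0, List.length_pos_iff.mpr hw⟩
  accept := Sum.inr '' M.accept
  step := fun q a => match q with
    | Sum.inr q => Sum.inr (M.step q a)
    | Sum.inl i =>
      if h : w.take i ++ [a] = w then Sum.inr M.start
      else Sum.inl (okPre_next w hw M.accepts (w.take i ++ [a])
        (by have := i.2; simp) h).choose

theorem okDFA_inr {σ Q : Type} (w : List σ) (hw : w ≠ []) (M : DFA σ Q) (s : List σ) (q : Q) :
    (okDFA w hw M).evalFrom (Sum.inr q) s = Sum.inr (M.evalFrom q s) := by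
  induction s generalizing q with
  | nil => rfl
  | cons a s ih => exact ih (M.step q a)

theorem okDFA_inl {σ Q : Type} (w : List σ) (hw : w ≠ []) (M : DFA σ Q)
    (hM : ∀ v s, s ∈ M.accepts → v ++ s ∈ M.accepts) (s : List σ) (i : Fin w.length) :
    (okDFA w hw M).evalFrom (Sum.inl i) s ∈ (okDFA w hw M).accept ↔
      w.take i ++ s ∈ OKPre w M.accepts := by
  induction s generalizing i with
  | nil =>
    constructor
    · rintro ⟨q, _, h⟩
      cases h
    · rintro ⟨u, t, h, _⟩
      have := congrArg List.length h
      have := i.2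
      simp at *
      omega
  | cons a s ih =>
    rw [DFA.evalFrom_cons]
    have e : w.take i ++ a :: s = (w.take i ++ [a]) ++ s := by simp
    rw [e]
    by_cases h : w.take i ++ [a] = w
    · have hs : (okDFA w hw M).step (Sum.inl i) a = Sum.inr M.start := by
        simp only [okDFA]
        exact dif_pos h
      rw [hs, okDFA_inr, h]
      have h1 : (Sum.inr (M.evalFrom M.start s) ∈ (okDFA w hw M).accept) ↔ s ∈ M.accepts :=
        Sum.inr_injective.mem_set_image
      rw [h1]
      constructor
      · intro h2
        exact ⟨[], s, rfl, h2⟩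
      · rintro ⟨u, t, h2, ht⟩
        have h3 : t <:+ s := by
          refine List.suffix_of_suffix_length_le (l₃ := w ++ s) ⟨u ++ w, ?_⟩ ⟨w, rfl⟩ ?_
          · simp [h2]
          · have := congrArg List.length h2
            simp at this
            omega
        obtain ⟨v, rfl⟩ := h3
        exact hM v t ht
    · have hs' : (okDFA w hw M).step (Sum.inl i) a = Sum.inl (okPre_next w hw M.accepts
          (w.take i ++ [a]) (by have := i.2; simp) h).choose := by
        simp only [okDFA]
        exact dif_neg h
      rw [hs', ih]
      exact (okPre_next w hw M.accepts (w.take i ++ [a]) (by have := i.2; simp) h).choose_spec s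


/-- **Ordered-occurrence automaton (concatenation of KMP automata).** Given nonempty words
`ws 0, …, ws (k-1)` over a finite alphabet `σ`, there is a DFA with at most
`1 + ∑ i, |ws i|` states whose accepted language is exactly
`Σ* w₁ Σ* w₂ Σ* ⋯ Σ* w_k Σ*`, i.e., the set of strings
`s = u₀ ++ w₁ ++ u₁ ++ w₂ ++ ⋯ ++ w_k ++ u_k` for some strings `u₀, …, u_k`. -/
theorem ordered_keywords_dfa {σ : Type} [Fintype σ] (k : ℕ)
    (ws : Fin k → List σ) (hws : ∀ i, ws i ≠ []) :
    ∃ (Q : Type) (_ : Fintype Q) (M : DFA σ Q),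
      Fintype.card Q ≤ 1 + ∑ i : Fin k, (ws i).length ∧
      M.accepts = {s : List σ | ∃ u : Fin (k + 1) → List σ,
        s = (List.ofFn fun i : Fin k => u i.castSucc ++ ws i).flatten ++ u (Fin.last k)} := by
  induction k with
  | zero =>
    refine ⟨Unit, inferInstance, ⟨fun _ _ => (), (), Set.univ⟩, by simp, ?_⟩
    ext s
    exact ⟨fun _ => okLang_zero ws s, fun _ => Set.mem_univ _⟩
  | succ k ih =>
    obtain ⟨Q, _, M, hc, hM⟩ := ih (fun i => ws i.succ) (fun i => hws _)
    change M.accepts = OKLang k (fun i => ws i.succ) at hM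
    refine ⟨Fin (ws 0).length ⊕ Q, inferInstance, okDFA (ws 0) (hws 0) M, ?_, ?_⟩
    · rw [Fintype.card_sum, Fintype.card_fin, Fin.sum_univ_succ]
      omega
    · ext s
      refine (okDFA_inl (ws 0) (hws 0) M ?_ s _).trans ?_
      · rw [hM]
        exact okLang_append _ _
      · rw [hM]
        exact (okLang_succ k ws s).symm
end
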